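/- arXiv:1403.1538 — 3 statements merged into one kernel-verified Lean document; each statement's English description precedes it below -/
import Mathlib

section
/- Let W ∈ C¹(ℝᵐ;ℝ) be nonnegative and let u ∈ C²(ℝⁿ;ℝᵐ), n ≥ 2, m ≥ 1, solve Δu = ∇W(u) on ℝⁿ. If u satisfies Modica's gradient bound (1/2)|∇u(x)|² ≤ W(u(x)) for all x ∈ ℝⁿ, then the function R ↦ (1/R^{n-1}) · ∫_{B_R} ( ((n-2)/2)|∇u|² + n·W(u) ) dx is nondecreasing on (0,∞), i.e. its derivative with respect to R is ≥ 0 for all R > 0. -/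
open MeasureTheory Metric Filter RealInnerProductSpace

/-- Squared Frobenius norm of the gradient: `|∇u|² = Σᵢ |u_{xᵢ}|²`. -/
noncomputable def gradSq {n m : ℕ}
    (u : EuclideanSpace ℝ (Fin n) → EuclideanSpace ℝ (Fin m))
    (x : EuclideanSpace ℝ (Fin n)) : ℝ :=
  ∑ i : Fin n, ‖fderiv ℝ u x (EuclideanSpace.single i 1)‖ ^ 2

/-- The Laplacian of `u`, computed componentwise: `Δu = Σᵢ u_{xᵢxᵢ}`. -/
noncomputable def vlap {n m : ℕ}
    (u : EuclideanSpace ℝ (Fin n) → EuclideanSpace ℝ (Fin m))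
    (x : EuclideanSpace ℝ (Fin n)) : EuclideanSpace ℝ (Fin m) :=
  ∑ i : Fin n,
    fderiv ℝ (fun y => fderiv ℝ u y (EuclideanSpace.single i 1)) x (EuclideanSpace.single i 1)

/-- The Allen–Cahn energy `E(u;Ω) = ∫_Ω ((1/2)|∇u|² + W(u)) dx`. -/
noncomputable def energy {n m : ℕ} (W : EuclideanSpace ℝ (Fin m) → ℝ)
    (u : EuclideanSpace ℝ (Fin n) → EuclideanSpace ℝ (Fin m))
    (Ω : Set (EuclideanSpace ℝ (Fin n))) : ℝ :=
  ∫ x in Ω, ((1 / 2) * gradSq u x + W (u x))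

/-- `u` is a globally minimizing solution: for every bounded domain `Ω` and every
perturbation `φ ∈ W^{1,2}_0(Ω;ℝᵐ) ∩ L^∞(Ω;ℝᵐ)` (encoded as a Lipschitz, hence
bounded and `W^{1,2}`, function supported in `Ω`), `E(u;Ω) ≤ E(u+φ;Ω)`. -/
def GloballyMinimizing {n m : ℕ} (W : EuclideanSpace ℝ (Fin m) → ℝ)
    (u : EuclideanSpace ℝ (Fin n) → EuclideanSpace ℝ (Fin m)) : Prop :=
  ∀ Ω : Set (EuclideanSpace ℝ (Fin n)), IsOpen Ω → Bornology.IsBounded Ω →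
    ∀ φ : EuclideanSpace ℝ (Fin n) → EuclideanSpace ℝ (Fin m),
      (∃ K : NNReal, LipschitzWith K φ) → tsupport φ ⊆ Ω →
      energy W u Ω ≤ energy W (u + φ) Ω

/-- Radial Lipschitz test function. -/
noncomputable def etaF (n k : ℕ) (r R : ℝ) (x : EuclideanSpace ℝ (Fin n)) : ℝ :=
  ((max r (min R ‖x‖)) ^ k)⁻¹ - (R ^ k)⁻¹

lemma etaF_lip (n k : ℕ) {r R : ℝ} (hr : 0 < r) (hrR : r < R) :
    ∃ C, LipschitzWith C (etaF n k r R) := by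
  have h1 : ContDiffOn ℝ 1 (fun t : ℝ => (t ^ k)⁻¹ - (R ^ k)⁻¹) (Set.Icc r R) := by
    apply ContDiffOn.sub _ contDiffOn_const
    apply ContDiffOn.inv
    · fun_prop
    · intro x hx
      exact (pow_pos (lt_of_lt_of_le hr hx.1) _).ne'
  obtain ⟨K, hK⟩ := h1.exists_lipschitzOnWith (by simp) (convex_Icc r R) isCompact_Icc
  have h2 : LipschitzWith 1 (fun x : EuclideanSpace ℝ (Fin n) => max r (min R ‖x‖)) :=
    (lipschitzWith_one_norm.const_min R).const_max r
  refine ⟨K * 1, ?_⟩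
  rw [← lipschitzOnWith_univ]
  refine LipschitzOnWith.comp (g := fun t : ℝ => (t ^ k)⁻¹ - (R ^ k)⁻¹) hK
    (lipschitzOnWith_univ.2 h2) ?_
  intro x _
  exact ⟨le_max_left _ _, max_le hrR.le (min_le_left _ _)⟩

lemma etaF_out (n k : ℕ) {r R : ℝ} (hrR : r < R) {x : EuclideanSpace ℝ (Fin n)}
    (hx : R ≤ ‖x‖) : etaF n k r R x = 0 := by
  simp [etaF, min_eq_left hx, max_eq_right hrR.le]

lemma etaF_in (n k : ℕ) {r R : ℝ} {x : EuclideanSpace ℝ (Fin n)}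
    (hx : ‖x‖ ≤ r) : etaF n k r R x = (r ^ k)⁻¹ - (R ^ k)⁻¹ := by
  simp [etaF, max_eq_left ((min_le_right R ‖x‖).trans hx)]

lemma etaF_mid (n k : ℕ) {r R : ℝ} {x : EuclideanSpace ℝ (Fin n)}
    (hx : r ≤ ‖x‖) (hx' : ‖x‖ ≤ R) : etaF n k r R x = (‖x‖ ^ k)⁻¹ - (R ^ k)⁻¹ := by
  simp [etaF, min_eq_right hx', max_eq_right hx]

lemma etaF_supp (n k : ℕ) {r R : ℝ} (hrR : r < R) :
    HasCompactSupport (etaF n k r R) := by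
  apply HasCompactSupport.intro (isCompact_closedBall (0 : EuclideanSpace ℝ (Fin n)) R)
  intro x hx
  apply etaF_out n k hrR
  simpa using (not_le.1 (by simpa using hx)).le

lemma etaF_deriv_out (n k : ℕ) {r R : ℝ} (hrR : r < R) {x : EuclideanSpace ℝ (Fin n)}
    (hx : R < ‖x‖) (v) : lineDeriv ℝ (etaF n k r R) x v = 0 := by
  have : etaF n k r R =ᶠ[nhds x] fun _ => 0 := by
    filter_upwards [(isOpen_lt continuous_const continuous_norm).mem_nhds hx] with y hy
    exact etaF_out n k hrR (le_of_lt hy)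
  rw [this.lineDeriv_eq]; exact (hasFDerivAt_const _ _).hasLineDerivAt v |>.lineDeriv

lemma etaF_deriv_in (n k : ℕ) {r R : ℝ} {x : EuclideanSpace ℝ (Fin n)}
    (hx : ‖x‖ < r) (v) : lineDeriv ℝ (etaF n k r R) x v = 0 := by
  have : etaF n k r R =ᶠ[nhds x] fun _ => (r ^ k)⁻¹ - (R ^ k)⁻¹ := by
    filter_upwards [(isOpen_lt continuous_norm continuous_const).mem_nhds hx] with y hy
    exact etaF_in n k (le_of_lt hy)
  rw [this.lineDeriv_eq]; exact (hasFDerivAt_const _ _).hasLineDerivAt v |>.lineDeriv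

lemma etaF_deriv_mid (n k : ℕ) {r R : ℝ} (hr : 0 < r) {x : EuclideanSpace ℝ (Fin n)}
    (hx : r < ‖x‖) (hx' : ‖x‖ < R) (v) :
    lineDeriv ℝ (etaF n k r R) x v = - (k * (‖x‖ ^ (k + 2))⁻¹) * inner ℝ x v := by
  have h1 : etaF n k r R =ᶠ[nhds x] fun y => (‖y‖ ^ k)⁻¹ - (R ^ k)⁻¹ := by
    filter_upwards [(isOpen_lt continuous_norm continuous_const).mem_nhds hx',
      (isOpen_lt continuous_const continuous_norm).mem_nhds hx] with y hy hy'
    exact etaF_mid n k (le_of_lt hy') (le_of_lt hy)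
  rw [h1.lineDeriv_eq]
  have hpos : 0 < ‖x‖ := hr.trans hx
  have hx0 : x ≠ 0 := norm_pos_iff.1 hpos
  have h2 : HasFDerivAt (fun y : EuclideanSpace ℝ (Fin n) => Real.sqrt (‖y‖ ^ 2))
      ((1 / (2 * Real.sqrt (‖x‖ ^ 2))) • (2 • (innerSL ℝ x))) x :=
    (hasStrictFDerivAt_norm_sq x).hasFDerivAt.sqrt (by positivity)
  simp only [Real.sqrt_sq (norm_nonneg _)] at h2
  have h3 : HasDerivAt (fun t : ℝ => (t ^ k)⁻¹ - (R ^ k)⁻¹)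
      (-(k * ‖x‖ ^ (k - 1)) / (‖x‖ ^ k) ^ 2) ‖x‖ :=
    ((hasDerivAt_pow k ‖x‖).inv (by positivity)).sub_const _
  have h4 := h3.comp_hasFDerivAt x h2
  have h5 := h4.hasLineDerivAt v
  rw [show (fun y : EuclideanSpace ℝ (Fin n) => (‖y‖ ^ k)⁻¹ - (R ^ k)⁻¹) =
    (fun t : ℝ => (t ^ k)⁻¹ - (R ^ k)⁻¹) ∘ fun y => ‖y‖ from rfl, h5.lineDeriv]
  simp only [smul_apply, innerSL_apply_apply, smul_eq_mul, nsmul_eq_mul]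
  rcases k with _ | k
  · simp
  · simp only [Nat.add_sub_cancel]
    field_simp
    push_cast
    ring

lemma ibp_sum (n : ℕ) {η : EuclideanSpace ℝ (Fin n) → ℝ} {C} (hη : LipschitzWith C η)
    (hηc : HasCompactSupport η) (Y : Fin n → EuclideanSpace ℝ (Fin n) → ℝ)
    (hY : ∀ i, ContDiff ℝ 1 (Y i)) (hYc : ∀ i, HasCompactSupport (Y i)) :
    Integrable (fun x => ∑ i, lineDeriv ℝ η x (EuclideanSpace.single i 1) * Y i x) ∧
    Integrable (fun x => (∑ i, fderiv ℝ (Y i) x (EuclideanSpace.single i 1)) * η x) ∧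
    ∫ x, (∑ i, fderiv ℝ (Y i) x (EuclideanSpace.single i 1)) * η x =
      - ∫ x, ∑ i, lineDeriv ℝ η x (EuclideanSpace.single i 1) * Y i x := by
  have i1 : ∀ i, Integrable (fun x => lineDeriv ℝ η x (EuclideanSpace.single i 1) * Y i x) :=
    fun i => ((hY i).continuous.integrable_of_hasCompactSupport (hYc i)).smul_of_top_right
      (hη.memLp_lineDeriv _)
  have i2 : ∀ i, Integrable (fun x => fderiv ℝ (Y i) x (EuclideanSpace.single i 1) * η x) := by
    intro i
    apply Continuous.integrable_of_hasCompactSupport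
    · have := (hY i).continuous_fderiv (by simp)
      have := hη.continuous
      fun_prop
    · exact hηc.mul_left
  simp only [Finset.sum_mul]
  refine ⟨integrable_finsetSum _ fun i _ => i1 i, integrable_finsetSum _ fun i _ => i2 i, ?_⟩
  rw [integral_finsetSum _ fun i _ => i1 i, integral_finsetSum _ fun i _ => i2 i,
    ← Finset.sum_neg_distrib]
  refine Finset.sum_congr rfl fun i _ => ?_
  obtain ⟨D, hD⟩ := (hY i).lipschitzWith_of_hasCompactSupport (hYc i) (by simp)
  have := hD.integral_lineDeriv_mul_eq (μ := volume) hη hηc (EuclideanSpace.single i 1)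
  simp only [lineDeriv_neg, neg_mul, integral_neg] at this
  rw [← this]
  congr 1; ext x
  rw [((hY i).differentiable (by simp)).differentiableAt.lineDeriv_eq_fderiv]

lemma radial_mono (n k : ℕ) (X : Fin n → EuclideanSpace ℝ (Fin n) → ℝ)
    (hX : ∀ i, ContDiff ℝ 1 (X i)) (f : EuclideanSpace ℝ (Fin n) → ℝ) (hf : Continuous f)
    (hdiv : ∀ x, ∑ i, fderiv ℝ (X i) x (EuclideanSpace.single i 1) = - f x)
    (hineq : ∀ x, 0 ≤ ‖x‖ ^ 2 * f x + k * ∑ i, x i * X i x)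
    {r R : ℝ} (hr : 0 < r) (hrR : r < R) :
    (r ^ k)⁻¹ * ∫ x in ball 0 r, f x ≤ (R ^ k)⁻¹ * ∫ x in ball 0 R, f x := by
  have hR : 0 < R := hr.trans hrR
  let χ : ContDiffBump (0 : EuclideanSpace ℝ (Fin n)) := ⟨R, R + 1, hR, by linarith⟩
  obtain ⟨C, hC⟩ := etaF_lip n k hr hrR
  have hc := etaF_supp n k hrR
  obtain ⟨I1, I2, I3⟩ := ibp_sum n hC hc (fun i x => χ x * X i x)
    (fun i => χ.contDiff.mul (hX i)) (fun i => χ.hasCompactSupport.mul_right)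
  have hfi : ∀ s, IntegrableOn f (ball 0 s) := fun s =>
    (hf.continuousOn.integrableOn_compact (isCompact_closedBall 0 s)).mono_set ball_subset_closedBall
  have J : ∀ s, Integrable ((ball (0 : EuclideanSpace ℝ (Fin n)) s).indicator f) := fun s =>
    (hfi s).integrable_indicator measurableSet_ball
  rw [← integral_indicator measurableSet_ball, ← integral_indicator measurableSet_ball,
    ← sub_nonpos, ← integral_const_mul, ← integral_const_mul,
    ← integral_sub ((J r).const_mul _) ((J R).const_mul _)]
  have key : - ((∫ x, (∑ i, fderiv ℝ (fun x => χ x * X i x) x (EuclideanSpace.single i 1))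
        * etaF n k r R x) +
      ∫ x, ∑ i, lineDeriv ℝ (etaF n k r R) x (EuclideanSpace.single i 1) * (χ x * X i x)) = 0 := by
    rw [I3]; ring
  rw [← key, ← integral_add I2 I1, ← integral_neg]
  apply integral_mono_ae (((J r).const_mul _).sub ((J R).const_mul _)) (I2.add I1).neg
  have s1 : ∀ᵐ x ∂(volume : Measure (EuclideanSpace ℝ (Fin n))), x ∉ sphere 0 r :=
    measure_eq_zero_iff_ae_notMem.1 (Measure.addHaar_sphere_of_ne_zero volume 0 hr.ne')
  have s2 : ∀ᵐ x ∂(volume : Measure (EuclideanSpace ℝ (Fin n))), x ∉ sphere 0 R :=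
    measure_eq_zero_iff_ae_notMem.1 (Measure.addHaar_sphere_of_ne_zero volume 0 hR.ne')
  filter_upwards [s1, s2] with x hx1 hx2
  simp only [mem_sphere_iff_norm, sub_zero] at hx1 hx2
  have hdv : ‖x‖ < R →
      ∑ i, fderiv ℝ (fun x => χ x * X i x) x (EuclideanSpace.single i 1) = - f x := by
    intro hx
    rw [← hdiv]
    refine Finset.sum_congr rfl fun i _ => ?_
    have : (fun x => χ x * X i x) =ᶠ[nhds x] X i := by
      filter_upwards [χ.eventuallyEq_one_of_mem_ball (x := x) (by simpa using hx)] with y hy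
      simp [hy]
    rw [this.fderiv_eq]
  have hχ : ‖x‖ < R → χ x = 1 := fun hx =>
    χ.one_of_mem_closedBall (by simpa using hx.le)
  simp only [Pi.sub_apply, Pi.neg_apply, Pi.add_apply]
  rcases lt_or_gt_of_ne hx2 with hxR | hxR
  · rw [hdv hxR, hχ hxR]
    rcases lt_or_gt_of_ne hx1 with hxr | hxr
    · simp only [etaF_deriv_in n k hxr, etaF_in n k hxr.le]
      simp [Set.indicator, hxr, hxR]
      apply le_of_eq; ring
    · simp only [etaF_deriv_mid n k hr hxr hxR, etaF_mid n k hxr.le hxR.le]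
      have e1 : ∀ i, inner ℝ x (EuclideanSpace.single i (1 : ℝ)) = x i := by
        intro i; simp [EuclideanSpace.inner_single_right]
      have e2 : ∑ i, -(k * (‖x‖ ^ (k + 2))⁻¹) * inner ℝ x (EuclideanSpace.single i (1 : ℝ))
          * (1 * X i x) = -(‖x‖ ^ (k + 2))⁻¹ * (k * ∑ i, x i * X i x) := by
        rw [Finset.mul_sum, Finset.mul_sum]
        refine Finset.sum_congr rfl fun i _ => ?_
        rw [e1]; ring
      rw [e2]
      have hp : 0 < ‖x‖ := hr.trans hxr
      simp [Set.indicator, hxr.not_gt, hxR]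
      have h := mul_nonneg (inv_nonneg.2 (pow_nonneg hp.le (k + 2))) (hineq x)
      have e3 : (‖x‖ ^ (k + 2))⁻¹ * (‖x‖ ^ 2 * f x) = (‖x‖ ^ k)⁻¹ * f x := by
        field_simp
        ring
      rw [mul_add, e3] at h
      linarith
  · simp [etaF_deriv_out n k hrR hxR, etaF_out n k hrR hxR.le, Set.indicator, hxR.not_gt,
      (hrR.trans hxR).not_gt]

lemma stress_div {n m : ℕ}
    (W : EuclideanSpace ℝ (Fin m) → ℝ) (hW : ContDiff ℝ 1 W)
    (u : EuclideanSpace ℝ (Fin n) → EuclideanSpace ℝ (Fin m))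
    (hu : ContDiff ℝ 2 u)
    (hsol : ∀ x, vlap u x = gradient W (u x)) (x : EuclideanSpace ℝ (Fin n)) :
    ∑ i, fderiv ℝ (fun y : EuclideanSpace ℝ (Fin n) =>
        inner ℝ (fderiv ℝ u y (EuclideanSpace.single i 1)) (fderiv ℝ u y y)
        - y i * ((1 / 2) * gradSq u y + W (u y))) x (EuclideanSpace.single i 1)
      = - (((n : ℝ) - 2) / 2 * gradSq u x + (n : ℝ) * W (u x)) := by
  have hDu : ContDiff ℝ 1 (fderiv ℝ u) := hu.fderiv_right (by norm_num)
  have hH : HasFDerivAt (fderiv ℝ u) (fderiv ℝ (fderiv ℝ u) x) x :=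
    ((hDu.differentiable (by simp)) x).hasFDerivAt
  have hsymm : ∀ a b, fderiv ℝ (fderiv ℝ u) x a b = fderiv ℝ (fderiv ℝ u) x b a :=
    hu.contDiffAt.isSymmSndFDerivAt (by simp)
  set H := fderiv ℝ (fderiv ℝ u) x with hHdef
  set D := fderiv ℝ u x with hD
  have huD : HasFDerivAt u D x := ((hu.differentiable (by simp)) x).hasFDerivAt
  have h1 : ∀ c, HasFDerivAt (fun y => fderiv ℝ u y c) (H.flip c) x := by
    intro c
    have := hH.clm_apply (hasFDerivAt_const c x)
    simpa using this
  have h2 : HasFDerivAt (fun y => fderiv ℝ u y y) (D + H.flip x) x := by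
    have := hH.clm_apply (hasFDerivAt_id x)
    simpa using this
  have hWx : HasFDerivAt (fun y => W (u y)) ((fderiv ℝ W (u x)).comp D) x :=
    ((hW.differentiable (by simp)) (u x)).hasFDerivAt.comp x huD
  obtain ⟨L, hL⟩ : ∃ L, L = fderiv ℝ (fun y => (1 / 2) * gradSq u y + W (u y)) x := ⟨_, rfl⟩
  have hg : HasFDerivAt (fun y => gradSq u y)
      (∑ k : Fin n, 2 • (innerSL ℝ (D (EuclideanSpace.single k 1))).comp
        (H.flip (EuclideanSpace.single k 1))) x := by
    unfold gradSq
    exact HasFDerivAt.fun_sum fun k _ => (h1 (EuclideanSpace.single k 1)).norm_sq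
  have hE := (hg.const_mul (1 / 2)).add hWx
  have hgradW : ∀ z, fderiv ℝ W (u x) z = inner ℝ (gradient W (u x)) z := by
    intro z
    simp [gradient]
  have hEx : ((1 / 2 : ℝ) • (∑ k : Fin n, 2 • (innerSL ℝ (D (EuclideanSpace.single k 1))).comp
        (H.flip (EuclideanSpace.single k 1))) + (fderiv ℝ W (u x)).comp D) x =
      (∑ k : Fin n, inner ℝ (D (EuclideanSpace.single k 1)) (H x (EuclideanSpace.single k 1)))
        + inner ℝ (vlap u x) (D x) := by
    rw [hsol, ← hgradW]
    simp [Finset.mul_sum]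
  set L := ((1 / 2 : ℝ) • (∑ k : Fin n, 2 • (innerSL ℝ (D (EuclideanSpace.single k 1))).comp
        (H.flip (EuclideanSpace.single k 1))) + (fderiv ℝ W (u x)).comp D) with hLdef
  have hbasis : ∑ i, x i • EuclideanSpace.single i (1 : ℝ) = x := by
    have := (EuclideanSpace.basisFun (Fin n) ℝ).sum_repr x
    simpa using this
  have hLx : ∑ i, x i * L (EuclideanSpace.single i 1) = L x := by
    conv_rhs => rw [← hbasis]
    simp
  have hvl : vlap u x = ∑ i, H (EuclideanSpace.single i 1) (EuclideanSpace.single i 1) := by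
    unfold vlap
    refine Finset.sum_congr rfl fun i _ => ?_
    rw [(h1 _).fderiv]; simp
  have hterm : ∀ i, fderiv ℝ (fun y : EuclideanSpace ℝ (Fin n) =>
        inner ℝ (fderiv ℝ u y (EuclideanSpace.single i 1)) (fderiv ℝ u y y)
        - y i * ((1 / 2) * gradSq u y + W (u y))) x (EuclideanSpace.single i 1)
      = inner ℝ (D (EuclideanSpace.single i 1)) (H x (EuclideanSpace.single i 1))
        + ‖D (EuclideanSpace.single i 1)‖ ^ 2
        + inner ℝ (H (EuclideanSpace.single i 1) (EuclideanSpace.single i 1)) (D x)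
        - ((1 / 2) * gradSq u x + W (u x)) - x i * L (EuclideanSpace.single i 1) := by
    intro i
    have hp : HasFDerivAt (fun y : EuclideanSpace ℝ (Fin n) => y i)
      (EuclideanSpace.proj i : EuclideanSpace ℝ (Fin n) →L[ℝ] ℝ) x :=
      (EuclideanSpace.proj i : EuclideanSpace ℝ (Fin n) →L[ℝ] ℝ).hasFDerivAt
    have h := ((h1 (EuclideanSpace.single i 1)).inner ℝ h2).sub (hp.mul hE)
    have h' := h.fderiv
    have h'' := congrArg (fun T => T (EuclideanSpace.single i (1 : ℝ))) h'
    refine Eq.trans h'' ?_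
    simp [inner_add_right, hsymm _ x, ← hD]
    ring
  simp only [hterm, Finset.sum_add_distrib, Finset.sum_sub_distrib, hLx, hEx]
  rw [hvl, sum_inner]
  simp only [gradSq, ← hD, Finset.sum_const, Finset.card_univ, Fintype.card_fin, nsmul_eq_mul]
  ring

/-- Theorem A.1, strong monotonicity formula: if moreover `u` satisfies Modica's
gradient bound `(1/2)|∇u|² ≤ W(u)`, then
`R ↦ R^{1-n} ∫_{B_R} ( ((n-2)/2)|∇u|² + n W(u) ) dx` is nondecreasing on `(0,∞)`. -/
theorem strong_monotonicity_formula
    (n m : ℕ) (hn : 2 ≤ n) (hm : 1 ≤ m)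
    (W : EuclideanSpace ℝ (Fin m) → ℝ) (hW : ContDiff ℝ 1 W)
    (hWnonneg : ∀ v, 0 ≤ W v)
    (u : EuclideanSpace ℝ (Fin n) → EuclideanSpace ℝ (Fin m))
    (hu : ContDiff ℝ 2 u)
    (hsol : ∀ x, vlap u x = gradient W (u x))
    (hmodica : ∀ x, (1 / 2) * gradSq u x ≤ W (u x)) :
    MonotoneOn
      (fun R : ℝ => (1 / R ^ (n - 1)) *
        ∫ x in ball (0 : EuclideanSpace ℝ (Fin n)) R,
          (((n : ℝ) - 2) / 2 * gradSq u x + (n : ℝ) * W (u x)))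
      (Set.Ioi 0) := by
  have hDu : ContDiff ℝ 1 (fderiv ℝ u) := hu.fderiv_right (by norm_num)
  have hu1 : ContDiff ℝ 1 u := hu.of_le (by norm_num)
  have hWu : ContDiff ℝ 1 (fun y => W (u y)) := hW.comp hu1
  have hg : ContDiff ℝ 1 (fun y => gradSq u y) := by
    unfold gradSq
    exact ContDiff.sum fun i _ => (hDu.clm_apply contDiff_const).norm_sq ℝ
  intro r hr R hR hrR
  rcases hrR.eq_or_lt with rfl | hlt
  · exact le_rfl
  simp only [one_div]
  refine radial_mono n (n - 1) (fun i y =>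
        inner ℝ (fderiv ℝ u y (EuclideanSpace.single i 1)) (fderiv ℝ u y y)
        - y i * ((1 / 2) * gradSq u y + W (u y))) ?_ _ ?_
        (stress_div W hW u hu hsol) ?_ hr hlt
  · intro i
    refine ContDiff.sub ((hDu.clm_apply contDiff_const).inner ℝ (hDu.clm_apply contDiff_id))
      (ContDiff.mul ?_ ((contDiff_const.mul hg).add hWu))
    exact (EuclideanSpace.proj i : EuclideanSpace ℝ (Fin n) →L[ℝ] ℝ).contDiff
  · exact (continuous_const.mul hg.continuous).add (continuous_const.mul hWu.continuous)
  · intro x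
    have hbasis : ∑ i, x i • EuclideanSpace.single i (1 : ℝ) = x := by
      have := (EuclideanSpace.basisFun (Fin n) ℝ).sum_repr x
      simpa using this
    have e1 : ∑ i, x i * inner ℝ (fderiv ℝ u x (EuclideanSpace.single i 1)) (fderiv ℝ u x x)
        = ‖fderiv ℝ u x x‖ ^ 2 := by
      rw [← real_inner_self_eq_norm_sq]
      conv_rhs => enter [2]; rw [← hbasis]
      rw [map_sum, sum_inner]
      simp [inner_smul_left, hbasis]
    have e2 : ∑ i, x i * (x i * ((1 / 2) * gradSq u x + W (u x)))
        = ‖x‖ ^ 2 * ((1 / 2) * gradSq u x + W (u x)) := by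
      rw [EuclideanSpace.real_norm_sq_eq, Finset.sum_mul]
      exact Finset.sum_congr rfl fun i _ => by ring
    simp only [mul_sub, Finset.sum_sub_distrib, e1, e2]
    rw [Nat.cast_sub (by omega)]
    push_cast
    have hn' : (2 : ℝ) ≤ n := by exact_mod_cast hn
    have a1 := mul_nonneg (sq_nonneg ‖x‖) (sub_nonneg.2 (hmodica x))
    have a2 := mul_nonneg (by linarith : (0 : ℝ) ≤ n - 1) (sq_nonneg ‖fderiv ℝ u x x‖)
    linarith
end

section
/- Let W ∈ C¹(ℝᵐ;ℝ), m ≥ 1, be nonnegative with W(a) = 0 for some a ∈ ℝᵐ. If u ∈ C²(ℝⁿ;ℝᵐ), n ≥ 2, is a bounded, globally minimizing solution of Δu = ∇W(u) on ℝⁿ, then there exists a constant C₂ > 0 such that ∫_{B_R} ( (1/2)|∇u|² + W(u) ) dx ≤ C₂ R^{n-1} for all R ≥ 1. -/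
open MeasureTheory Metric Filter RealInnerProductSpace

lemma aux_alg (P q s : ℝ) (hs0 : 0 ≤ s) (hs1 : s ≤ 1) :
    ((1 - s ^ 2) * P + 2 * s * q) ^ 2 ≤ P ^ 2 + 8 * q ^ 2 := by
  have h2 : s ^ 2 ≤ 1 := by nlinarith
  nlinarith [mul_nonneg (sub_nonneg.2 h2) (sq_nonneg (s * P - 2 * q)), mul_nonneg (sq_nonneg s) (sq_nonneg P), mul_nonneg (sub_nonneg.2 h2) (sq_nonneg q), sq_nonneg q,
    mul_nonneg (sq_nonneg s) (sq_nonneg q)]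

lemma aux_vec {m : ℕ} (p w : EuclideanSpace ℝ (Fin m)) (s d D K : ℝ) (hs0 : 0 ≤ s) (hs1 : s ≤ 1)
    (hd : |d| ≤ D) (hw : ‖w‖ ≤ K) :
    ‖(1 - s ^ 2) • p + (2 * s * d) • w‖ ^ 2 ≤ ‖p‖ ^ 2 + 8 * (D * K) ^ 2 := by
  have h2 : 0 ≤ 1 - s ^ 2 := by nlinarith
  have h1 : ‖(1 - s ^ 2) • p + (2 * s * d) • w‖ ≤ (1 - s ^ 2) * ‖p‖ + 2 * s * (D * K) := by
    refine (norm_add_le _ _).trans ?_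
    rw [norm_smul, norm_smul, Real.norm_of_nonneg h2, Real.norm_eq_abs, abs_mul, abs_of_nonneg (by positivity : 0 ≤ 2 * s), mul_assoc]
    gcongr
    exact (abs_nonneg d).trans hd
  calc _ ≤ ((1 - s ^ 2) * ‖p‖ + 2 * s * (D * K)) ^ 2 := by gcongr
    _ ≤ _ := aux_alg _ _ _ hs0 hs1

lemma gradSq_nonneg' {n m : ℕ}
    (u : EuclideanSpace ℝ (Fin n) → EuclideanSpace ℝ (Fin m)) (x) : 0 ≤ gradSq u x :=
  Finset.sum_nonneg fun _ _ => sq_nonneg _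

lemma continuous_dens {n m : ℕ} (W : EuclideanSpace ℝ (Fin m) → ℝ) (hW : Continuous W)
    (u : EuclideanSpace ℝ (Fin n) → EuclideanSpace ℝ (Fin m)) (hu : ContDiff ℝ 1 u) :
    Continuous (fun x => (1 / 2) * gradSq u x + W (u x)) := by
  have h1 : Continuous (fderiv ℝ u) := hu.continuous_fderiv (by norm_num)
  have h2 : Continuous u := hu.continuous
  unfold gradSq
  fun_prop

lemma S_deriv_bdd : ∃ M : ℝ, 0 ≤ M ∧ ∀ t ∈ Set.Icc (-2 : ℝ) 1, |deriv Real.smoothTransition t| ≤ M := by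
  have hc : Continuous (deriv Real.smoothTransition) :=
    (Real.smoothTransition.contDiff (n := 1)).continuous_deriv (by norm_num)
  obtain ⟨M, hM⟩ := (isCompact_Icc (a := (-2 : ℝ)) (b := 1)).exists_bound_of_continuousOn hc.continuousOn
  exact ⟨M, (norm_nonneg _).trans (hM 0 (by norm_num)), fun t ht => hM t ht⟩

/-- cutoff -/
noncomputable def etaC {n : ℕ} (R : ℝ) (x : EuclideanSpace ℝ (Fin n)) : ℝ :=
  Real.smoothTransition (((R + 1) ^ 2 - ‖x‖ ^ 2) / (2 * R + 1))

lemma etaC_contDiff {n : ℕ} (R : ℝ) : ContDiff ℝ 1 (etaC (n := n) R) := by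
  unfold etaC
  exact Real.smoothTransition.contDiff.comp ((contDiff_const.sub (contDiff_norm_sq ℝ)).div_const _)

lemma etaC_one {n : ℕ} {R : ℝ} (hR : 1 ≤ R) {x : EuclideanSpace ℝ (Fin n)} (hx : ‖x‖ ≤ R) :
    etaC R x = 1 := by
  apply Real.smoothTransition.one_of_one_le
  rw [le_div_iff₀ (by linarith)]
  nlinarith [norm_nonneg x]

lemma etaC_zero {n : ℕ} {R : ℝ} (hR : 1 ≤ R) {x : EuclideanSpace ℝ (Fin n)} (hx : R + 1 ≤ ‖x‖) :
    etaC R x = 0 := by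
  apply Real.smoothTransition.zero_of_nonpos
  apply div_nonpos_of_nonpos_of_nonneg <;> nlinarith [norm_nonneg x]

lemma etaC_fderiv {n : ℕ} {R M : ℝ} (hR : 1 ≤ R) (hM0 : 0 ≤ M)
    (hM : ∀ t ∈ Set.Icc (-2 : ℝ) 1, |deriv Real.smoothTransition t| ≤ M)
    {x : EuclideanSpace ℝ (Fin n)} (hx : R ≤ ‖x‖) (hx2 : ‖x‖ ≤ R + 2)
    (e : EuclideanSpace ℝ (Fin n)) (he : ‖e‖ = 1) :
    |fderiv ℝ (etaC R) x e| ≤ 2 * M := by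
  have hpos : 0 < 2 * R + 1 := by linarith
  set t := ((R + 1) ^ 2 - ‖x‖ ^ 2) / (2 * R + 1) with ht
  have hS : HasDerivAt Real.smoothTransition (deriv Real.smoothTransition t) t :=
    ((Real.smoothTransition.contDiff (n := 1)).differentiable (by norm_num) t).hasDerivAt
  have hin : HasFDerivAt (fun y : EuclideanSpace ℝ (Fin n) => ((R + 1) ^ 2 - ‖y‖ ^ 2) / (2 * R + 1))
      ((2 * R + 1)⁻¹ • (-((2 : ℕ) • (innerSL ℝ x : EuclideanSpace ℝ (Fin n) →L[ℝ] ℝ)))) x := by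
    have := ((hasStrictFDerivAt_norm_sq x).hasFDerivAt.const_sub ((R + 1) ^ 2)).const_mul (2 * R + 1)⁻¹
    refine this.congr_of_eventuallyEq (Filter.Eventually.of_forall fun y => ?_)
    simp [div_eq_inv_mul]
  have h := hS.comp_hasFDerivAt x hin
  have h' : fderiv ℝ (etaC R) x = _ := HasFDerivAt.fderiv h
  rw [h']
  have hval : (deriv Real.smoothTransition t • ((2 * R + 1)⁻¹ • (-((2 : ℕ) • (innerSL ℝ x : EuclideanSpace ℝ (Fin n) →L[ℝ] ℝ))))) e
      = deriv Real.smoothTransition t * (-(2 * inner ℝ x e) / (2 * R + 1)) := by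
    simp
    ring
  rw [hval, abs_mul]
  have htm : t ∈ Set.Icc (-2 : ℝ) 1 := by
    rw [ht, Set.mem_Icc, le_div_iff₀ hpos, div_le_iff₀ hpos]
    constructor <;> nlinarith
  have h3 : |-(2 * inner ℝ x e) / (2 * R + 1)| ≤ 2 := by
    rw [abs_div, abs_neg, abs_mul, abs_of_pos hpos, div_le_iff₀ hpos]
    have := abs_real_inner_le_norm x e
    rw [he] at this
    norm_num
    linarith
  calc _ ≤ M * 2 := by gcongr; exact hM t htm
    _ = _ := by ring

lemma energy_shell {n m : ℕ} (W : EuclideanSpace ℝ (Fin m) → ℝ) (hW : Continuous W)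
    (hWnonneg : ∀ v, 0 ≤ W v)
    (a : EuclideanSpace ℝ (Fin m)) (hWa : W a = 0)
    (u : EuclideanSpace ℝ (Fin n) → EuclideanSpace ℝ (Fin m))
    (hu : ContDiff ℝ 1 u)
    (hbdd : ∃ C, ∀ x, ‖u x‖ ≤ C)
    (hmin : GloballyMinimizing W u) :
    ∃ C : ℝ, 0 ≤ C ∧ ∀ R : ℝ, 1 ≤ R →
      energy W u (ball 0 R) ≤ C * volume.real (ball (0 : EuclideanSpace ℝ (Fin n)) (R + 2) \ ball 0 R) := by
  obtain ⟨C, hC⟩ := hbdd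
  have hC0 : 0 ≤ C := (norm_nonneg _).trans (hC 0)
  obtain ⟨M, hM0, hM⟩ := S_deriv_bdd
  obtain ⟨B, hB⟩ := (isCompact_closedBall (0 : EuclideanSpace ℝ (Fin m)) (C + ‖a‖)).exists_bound_of_continuousOn hW.continuousOn
  have hB0 : 0 ≤ B := (norm_nonneg _).trans (hB 0 (by simp; positivity))
  set A : ℝ := (1 / 2) * (n * (8 * (2 * M * (C + ‖a‖)) ^ 2)) + B with hA
  refine ⟨A, by positivity, fun R hR => ?_⟩
  set η : EuclideanSpace ℝ (Fin n) → ℝ := etaC R with hη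
  have hηc : ContDiff ℝ 1 η := etaC_contDiff R
  have hη0 : ∀ x, 0 ≤ η x := fun x => Real.smoothTransition.nonneg _
  have hη1 : ∀ x, η x ≤ 1 := fun x => Real.smoothTransition.le_one _
  set φ : EuclideanSpace ℝ (Fin n) → EuclideanSpace ℝ (Fin m) := fun x => (η x ^ 2) • (a - u x) with hφ
  have hφc : ContDiff ℝ 1 φ := (hηc.pow 2).smul (contDiff_const.sub hu)
  have hts : tsupport φ ⊆ closedBall 0 (R + 1) := by
    apply closure_minimal _ isClosed_closedBall
    intro x hx
    by_contra hx'
    apply hx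
    simp only [mem_closedBall, dist_zero_right, not_le] at hx'
    simp [hφ, hη, etaC_zero hR hx'.le]
  have hcs : HasCompactSupport φ := (isCompact_closedBall _ _).of_isClosed_subset (isClosed_tsupport _) hts
  have hlip : ∃ K : NNReal, LipschitzWith K φ :=
    hφc.lipschitzWith_of_hasCompactSupport hcs (by norm_num)
  have hE := hmin (ball 0 (R + 2)) isOpen_ball isBounded_ball φ hlip
    (hts.trans (closedBall_subset_ball (by linarith)))
  have hcu := continuous_dens W hW u hu
  have hcv := continuous_dens W hW (u + φ) (hu.add hφc)
  have hsub : ball (0 : EuclideanSpace ℝ (Fin n)) R ⊆ ball 0 (R + 2) := ball_subset_ball (by linarith)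
  have hint : ∀ f : EuclideanSpace ℝ (Fin n) → ℝ, Continuous f → IntegrableOn f (ball 0 (R + 2)) :=
    fun f hf => (hf.continuousOn.integrableOn_compact (isCompact_closedBall 0 (R+2))).mono_set ball_subset_closedBall
  -- splitting
  have split : ∀ f : EuclideanSpace ℝ (Fin n) → ℝ, Continuous f →
      ∫ x in ball 0 (R + 2), f x = (∫ x in ball 0 R, f x) + ∫ x in ball 0 (R + 2) \ ball 0 R, f x := by
    intro f hf
    rw [setIntegral_sdiff measurableSet_ball (hint f hf) hsub]
    ring
  have hdisj : ∫ x in ball 0 R, ((1 / 2) * gradSq (u + φ) x + W ((u + φ) x)) = 0 := by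
    apply setIntegral_eq_zero_of_forall_eq_zero
    intro x hx
    have hev : (u + φ) =ᶠ[nhds x] fun _ => a := by
      filter_upwards [isOpen_ball.mem_nhds hx] with y hy
      have : η y = 1 := etaC_one hR (by simpa using (mem_ball.1 hy).le)
      simp [hφ, this]
    have h1 : (u + φ) x = a := hev.self_of_nhds
    have h2 : fderiv ℝ (u + φ) x = 0 := by rw [hev.fderiv_eq]; simp
    rw [h1, hWa]
    simp [gradSq, h2]
  have hpt : ∀ x ∈ ball (0 : EuclideanSpace ℝ (Fin n)) (R + 2) \ ball 0 R,
      (1 / 2) * gradSq (u + φ) x + W ((u + φ) x) ≤ ((1 / 2) * gradSq u x + W (u x)) + A := by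
    rintro x ⟨hx2, hx1⟩
    simp only [mem_ball, dist_zero_right, not_lt] at hx1 hx2
    have hw : ‖a - u x‖ ≤ C + ‖a‖ := by
      have := norm_sub_le a (u x)
      linarith [hC x]
    have hWv : W ((u + φ) x) ≤ B := by
      refine (le_abs_self _).trans (hB _ ?_)
      have h2 : 0 ≤ 1 - η x ^ 2 := by nlinarith [hη0 x, hη1 x]
      have : (u + φ) x = (1 - η x ^ 2) • u x + (η x ^ 2) • a := by
        simp only [hφ, Pi.add_apply]; module
      rw [this, mem_closedBall, dist_zero_right]
      refine (norm_add_le _ _).trans ?_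
      rw [norm_smul, norm_smul, Real.norm_of_nonneg h2, Real.norm_of_nonneg (sq_nonneg _)]
      nlinarith [hC x, norm_nonneg (u x), norm_nonneg a, sq_nonneg (η x)]
    have hg : gradSq (u + φ) x ≤ gradSq u x + n * (8 * (2 * M * (C + ‖a‖)) ^ 2) := by
      have : gradSq u x + n * (8 * (2 * M * (C + ‖a‖)) ^ 2)
          = ∑ i : Fin n, (‖fderiv ℝ u x (EuclideanSpace.single i 1)‖ ^ 2 + 8 * (2 * M * (C + ‖a‖)) ^ 2) := by
        simp [gradSq, Finset.sum_add_distrib]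
      rw [this]
      apply Finset.sum_le_sum
      intro i _
      set e := EuclideanSpace.single i (1 : ℝ) with he
      have hud : HasFDerivAt u (fderiv ℝ u x) x := (hu.differentiable (by norm_num) x).hasFDerivAt
      have hηd : HasFDerivAt η (fderiv ℝ η x) x := (hηc.differentiable (by norm_num) x).hasFDerivAt
      have hd := hud.add ((hηd.pow 2).smul (hud.const_sub a))
      have hd' : fderiv ℝ (u + φ) x = _ := HasFDerivAt.fderiv hd
      have : fderiv ℝ (u + φ) x e = (1 - η x ^ 2) • fderiv ℝ u x e + (2 * η x * fderiv ℝ η x e) • (a - u x) := by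
        rw [hd']
        simp
        module
      rw [this]
      exact aux_vec _ _ _ _ _ _ (hη0 x) (hη1 x)
        (etaC_fderiv hR hM0 hM hx1 hx2.le e (by simp [he])) hw
    have := hWnonneg (u x)
    rw [hA]
    linarith
  have hmono : ∫ x in ball 0 (R + 2) \ ball 0 R, ((1 / 2) * gradSq (u + φ) x + W ((u + φ) x)) ≤
      ∫ x in ball 0 (R + 2) \ ball 0 R, (((1 / 2) * gradSq u x + W (u x)) + A) :=
    setIntegral_mono_on ((hint _ hcv).mono_set Set.sdiff_subset)
      ((hint _ (hcu.add continuous_const)).mono_set Set.sdiff_subset)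
      (measurableSet_ball.diff measurableSet_ball) hpt
  rw [integral_add ((hint _ hcu).mono_set Set.sdiff_subset)
    ((hint _ continuous_const).mono_set Set.sdiff_subset), setIntegral_const, smul_eq_mul] at hmono
  unfold energy at hE ⊢
  rw [split _ hcu, split _ hcv, hdisj] at hE
  linarith

lemma pow_diff_bound (n : ℕ) (hn : 1 ≤ n) (R : ℝ) (hR : 1 ≤ R) :
    (R + 2) ^ n - R ^ n ≤ (2 * n * 3 ^ (n - 1)) * R ^ (n - 1) := by
  have h := (Commute.all (R + 2) R).geom_sum₂_mul n
  rw [← h]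
  have h2 : ∑ i ∈ Finset.range n, (R + 2) ^ i * R ^ (n - 1 - i) ≤ ∑ i ∈ Finset.range n, (3 * R) ^ (n - 1) := by
    apply Finset.sum_le_sum
    intro i hi
    have hi' : i ≤ n - 1 := by have := Finset.mem_range.1 hi; omega
    calc (R + 2) ^ i * R ^ (n - 1 - i) ≤ (3 * R) ^ i * (3 * R) ^ (n - 1 - i) := by
          gcongr <;> linarith
      _ = _ := by rw [← pow_add]; congr 1; omega
  simp only [Finset.sum_const, Finset.card_range, nsmul_eq_mul, mul_pow] at h2
  nlinarith

/-- The basic energy estimate (2.3): for a bounded globally minimizing solution,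
`∫_{B_R} ((1/2)|∇u|² + W(u)) dx ≤ C₂ R^{n-1}` for all `R ≥ 1`. -/
theorem energy_upper_bound
    (n m : ℕ) (hn : 2 ≤ n) (hm : 1 ≤ m)
    (W : EuclideanSpace ℝ (Fin m) → ℝ) (hW : ContDiff ℝ 1 W)
    (hWnonneg : ∀ v, 0 ≤ W v)
    (a : EuclideanSpace ℝ (Fin m)) (hWa : W a = 0)
    (u : EuclideanSpace ℝ (Fin n) → EuclideanSpace ℝ (Fin m))
    (hu : ContDiff ℝ 2 u)
    (hbdd : ∃ C, ∀ x, ‖u x‖ ≤ C)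
    (hsol : ∀ x, vlap u x = gradient W (u x))
    (hmin : GloballyMinimizing W u) :
    ∃ C₂ : ℝ, 0 < C₂ ∧ ∀ R : ℝ, 1 ≤ R →
      energy W u (ball 0 R) ≤ C₂ * R ^ (n - 1) := by
  obtain ⟨C, hC0, hC⟩ := energy_shell W hW.continuous hWnonneg a hWa u
    (hu.of_le (by norm_num)) hbdd hmin
  set V := volume.real (ball (0 : EuclideanSpace ℝ (Fin n)) 1) with hV
  have hV0 : 0 ≤ V := measureReal_nonneg
  refine ⟨C * (2 * n * 3 ^ (n - 1) * V) + 1, by positivity, fun R hR => (hC R hR).trans ?_⟩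
  have hball : ∀ r : ℝ, 0 ≤ r → volume.real (ball (0 : EuclideanSpace ℝ (Fin n)) r) = r ^ n * V := by
    intro r hr
    have : Nonempty (Fin n) := ⟨⟨0, by omega⟩⟩
    have := Measure.addHaar_ball (volume : Measure (EuclideanSpace ℝ (Fin n))) 0 hr
    rw [hV, Measure.real, Measure.real, this, ENNReal.toReal_mul, ENNReal.toReal_ofReal (by positivity)]
    simp
  have hdiff : volume.real (ball (0 : EuclideanSpace ℝ (Fin n)) (R + 2) \ ball 0 R)
      = ((R + 2) ^ n - R ^ n) * V := by
    rw [measureReal_sdiff (ball_subset_ball (by linarith)) measurableSet_ball,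
      hball _ (by linarith), hball _ (by linarith)]
    ring
  rw [hdiff]
  have hb := pow_diff_bound n (by omega) R hR
  have hp : 0 ≤ R ^ (n - 1) := by positivity
  calc C * (((R + 2) ^ n - R ^ n) * V)
      ≤ C * (((2 * n * 3 ^ (n - 1)) * R ^ (n - 1)) * V) := by gcongr
    _ ≤ _ := by nlinarith
end

section
/- Let W ∈ C²(ℝᵐ;ℝ), m ≥ 1, be nonnegative with W(u) > 0 for all u ≠ a and W(a) = 0 for some a ∈ ℝᵐ, and assume the Hessian of W at a is positive definite, i.e. W_{uu}(a)ν · ν > 0 for every unit vector ν ∈ S^{m-1}. If u ∈ C²(ℝⁿ;ℝᵐ), n ≥ 2, is a bounded, globally minimizing solution of Δu = ∇W(u) on ℝⁿ, then (1/R^{n-1}) · ∫_{B_R} |u(x) − a|² dx → 0 as R → ∞. -/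
open MeasureTheory Metric Filter RealInnerProductSpace

theorem aux_W_upper {m : ℕ} (W : EuclideanSpace ℝ (Fin m) → ℝ) (hW : ContDiff ℝ 2 W)
    (a : EuclideanSpace ℝ (Fin m)) (hWa : W a = 0) (hWpos : ∀ v, v ≠ a → 0 < W v) (M : ℝ) :
    ∃ L : ℝ, 0 ≤ L ∧ ∀ v, ‖v - a‖ ≤ M → W v ≤ L * ‖v - a‖ ^ 2 := by
  have hd : ContDiff ℝ 1 (fderiv ℝ W) := hW.fderiv_right (by norm_num)
  have hWd : Differentiable ℝ W := hW.differentiable (by norm_num)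
  have hmin : fderiv ℝ W a = 0 := by
    apply IsLocalMin.fderiv_eq_zero
    refine Eventually.of_forall fun v => ?_
    rcases eq_or_ne v a with h | h
    · rw [h]
    · rw [hWa]; exact (hWpos v h).le
  have hc : Continuous (fun v => fderiv ℝ (fderiv ℝ W) v) := hd.continuous_fderiv (by norm_num)
  obtain ⟨L, hL⟩ := (isCompact_closedBall a M).exists_bound_of_continuousOn
    (f := fun v => fderiv ℝ (fderiv ℝ W) v) hc.continuousOn
  refine ⟨max L 0, le_max_right _ _, fun v hv => ?_⟩
  have hM : 0 ≤ M := (norm_nonneg _).trans hv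
  have hvb : v ∈ closedBall a M := by simpa [dist_eq_norm] using hv
  have h1 : ∀ z ∈ closedBall a M, ‖fderiv ℝ W z‖ ≤ max L 0 * ‖z - a‖ := by
    intro z hz
    have := (convex_closedBall a M).norm_image_sub_le_of_norm_fderiv_le
      (f := fderiv ℝ W) (C := max L 0) (fun y _ => hd.differentiable (by norm_num) y)
      (fun y hy => (hL y hy).trans (le_max_left _ _)) (mem_closedBall_self hM) hz
    simpa [hmin] using this
  have h2 := (convex_closedBall a ‖v - a‖).norm_image_sub_le_of_norm_fderiv_le
      (f := W) (C := max L 0 * ‖v - a‖) (fun y _ => hWd y)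
      (fun y hy => by
        have hy' : ‖y - a‖ ≤ ‖v - a‖ := by simpa [dist_eq_norm] using hy
        refine (h1 y (by simpa [dist_eq_norm] using hy'.trans hv)).trans ?_
        gcongr) (mem_closedBall_self (norm_nonneg _))
      (show v ∈ closedBall a ‖v - a‖ by simp [dist_eq_norm])
  rw [hWa, sub_zero] at h2
  calc W v ≤ ‖W v‖ := Real.le_norm_self _
    _ ≤ _ := h2
    _ = _ := by ring

theorem aux_W_lower {m : ℕ} (W : EuclideanSpace ℝ (Fin m) → ℝ) (hW : ContDiff ℝ 2 W)
    (a : EuclideanSpace ℝ (Fin m)) (hWa : W a = 0) (hWpos : ∀ v, v ≠ a → 0 < W v)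
    (hHess : ∀ ν : EuclideanSpace ℝ (Fin m), ‖ν‖ = 1 →
      0 < ⟪fderiv ℝ (fun v => gradient W v) a ν, ν⟫) (M : ℝ) :
    ∃ c : ℝ, 0 < c ∧ ∀ v, ‖v - a‖ ≤ M → c * ‖v - a‖ ^ 2 ≤ W v := by
  have hWd : Differentiable ℝ W := hW.differentiable (by norm_num)
  have hg : ContDiff ℝ 1 (fun v => gradient W v) := by
    have hd : ContDiff ℝ 1 (fderiv ℝ W) := hW.fderiv_right (by norm_num)
    exact (InnerProductSpace.toDual ℝ (EuclideanSpace ℝ (Fin m))).symm.contDiff.comp hd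
  have hmin : gradient W a = 0 := by
    have : fderiv ℝ W a = 0 := by
      apply IsLocalMin.fderiv_eq_zero
      refine Eventually.of_forall fun v => ?_
      rcases eq_or_ne v a with h | h
      · rw [h]
      · rw [hWa]; exact (hWpos v h).le
    simp [gradient, this]
  set H := fderiv ℝ (fun v => gradient W v) a with hH
  obtain ⟨k, hk0, hk⟩ := (isCompact_sphere (0 : EuclideanSpace ℝ (Fin m)) 1).exists_forall_le'
    (f := fun ν => ⟪H ν, ν⟫) (a := 0) (by fun_prop)
    (fun ν hν => hHess ν (by simpa using hν))
  have hquad : ∀ w, k * ‖w‖ ^ 2 ≤ ⟪H w, w⟫ := by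
    intro w
    rcases eq_or_ne w 0 with h | h
    · simp [h]
    · have hn : 0 < ‖w‖ := norm_pos_iff.2 h
      have := hk (‖w‖⁻¹ • w) (by simp [norm_smul, hn.ne'])
      simp only [map_smul, inner_smul_left, inner_smul_right] at this
      simp at this
      field_simp at this
      nlinarith
  have hdiff : HasFDerivAt (fun v => gradient W v) H a :=
    (hg.differentiable (by norm_num) a).hasFDerivAt
  have hlit := hdiff.isLittleO.def (show 0 < k / 2 by positivity)
  obtain ⟨δ, hδ, hball⟩ := Metric.eventually_nhds_iff.1 hlit
  have hnear : ∀ v, ‖v - a‖ < δ → k / 4 * ‖v - a‖ ^ 2 ≤ W v := by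
    intro v hv
    set w := v - a with hw
    let h : ℝ → ℝ := fun t => W (a + t • w) - k / 4 * t ^ 2 * ‖w‖ ^ 2
    have hder : ∀ t, HasDerivAt h (⟪gradient W (a + t • w), w⟫ - k / 2 * t * ‖w‖ ^ 2) t := by
      intro t
      have h1 : HasDerivAt (fun t : ℝ => a + t • w) w t := by
        simpa using ((hasDerivAt_id t).smul_const w).const_add a
      have h2 := (hWd (a + t • w)).hasFDerivAt.comp_hasDerivAt t h1
      have h3 : fderiv ℝ W (a + t • w) w = ⟪gradient W (a + t • w), w⟫ := by
        simp [gradient]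
      rw [h3] at h2
      have h4 : HasDerivAt (fun t : ℝ => k / 4 * t ^ 2 * ‖w‖ ^ 2) (k / 2 * t * ‖w‖ ^ 2) t := by
        have := (((hasDerivAt_id t).pow 2).const_mul (k / 4)).mul_const (‖w‖ ^ 2)
        refine this.congr_deriv ?_
        simp only [id]
        ring
      exact h2.sub h4
    have hmono : MonotoneOn h (Set.Icc 0 1) := by
      apply monotoneOn_of_deriv_nonneg (convex_Icc _ _)
        (fun t _ => (hder t).continuousAt.continuousWithinAt)
        (fun t _ => (hder t).differentiableAt.differentiableWithinAt)
      intro t ht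
      rw [interior_Icc] at ht
      rw [(hder t).deriv]
      have hb := @hball (a + t • w) (by
        rw [dist_eq_norm, add_sub_cancel_left, norm_smul, Real.norm_of_nonneg ht.1.le]
        nlinarith [norm_nonneg w, ht.2])
      rw [hmin, sub_zero, add_sub_cancel_left, norm_smul, Real.norm_of_nonneg ht.1.le] at hb
      have hi := abs_real_inner_le_norm (gradient W (a + t • w) - H (t • w)) w
      rw [inner_sub_left, map_smul, inner_smul_left] at hi
      have hi2 := (abs_le.1 hi).1
      rw [map_smul] at hb
      have hi3 := mul_le_mul_of_nonneg_right hb (norm_nonneg w)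
      have hq := mul_le_mul_of_nonneg_left (hquad w) ht.1.le
      simp only [conj_trivial] at hi2
      nlinarith
    have := hmono (by simp) (by simp) (zero_le_one : (0 : ℝ) ≤ 1)
    simp [h, hWa] at this
    simpa [hw] using this
  have hcomp : IsCompact (closedBall a M \ ball a δ) := (isCompact_closedBall a M).diff isOpen_ball
  obtain ⟨k2, hk2, hfar⟩ := hcomp.exists_forall_le' (f := W) (a := 0) hW.continuous.continuousOn
    (fun v hv => hWpos v (by
      rintro rfl
      exact hv.2 (mem_ball_self hδ)))
  refine ⟨min (k / 4) (k2 / (M ^ 2 + 1)), by positivity, fun v hv => ?_⟩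
  rcases lt_or_ge (‖v - a‖) δ with h | h
  · refine le_trans ?_ (hnear v h)
    gcongr
    exact min_le_left _ _
  · have := hfar v ⟨by simpa [dist_eq_norm] using hv, by simpa [dist_eq_norm] using h⟩
    refine le_trans ?_ this
    calc _ ≤ k2 / (M ^ 2 + 1) * M ^ 2 := by
          gcongr
          exact min_le_right _ _
      _ ≤ k2 := by
          rw [div_mul_eq_mul_div, div_le_iff₀ (by positivity)]
          nlinarith

theorem aux_step : ∃ T : NNReal, LipschitzWith T Real.smoothTransition := by
  have hc : ContDiff ℝ 1 Real.smoothTransition := Real.smoothTransition.contDiff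
  obtain ⟨T, hT⟩ := (isCompact_Icc (a := (0 : ℝ)) (b := 1)).exists_bound_of_continuousOn
    (hc.continuous_deriv le_rfl).continuousOn
  refine ⟨(max T 0).toNNReal, lipschitzWith_of_nnnorm_deriv_le
    (hc.differentiable (by norm_num)) fun t => ?_⟩
  rw [← NNReal.coe_le_coe, coe_nnnorm, Real.coe_toNNReal _ (le_max_right _ _)]
  by_cases ht : t ∈ Set.Icc (0 : ℝ) 1
  · exact (hT t ht).trans (le_max_left _ _)
  · have : deriv Real.smoothTransition t = 0 := by
      rw [Set.mem_Icc, not_and_or, not_le, not_le] at ht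
      rcases ht with ht | ht
      · apply IsLocalMin.deriv_eq_zero
        refine Eventually.of_forall fun v => ?_
        rw [Real.smoothTransition.zero_of_nonpos ht.le]
        exact Real.smoothTransition.nonneg v
      · apply IsLocalMax.deriv_eq_zero
        refine Eventually.of_forall fun v => ?_
        rw [Real.smoothTransition.one_of_one_le ht.le]
        exact Real.smoothTransition.le_one v
    simp [this]

theorem aux_rho {n : ℕ} :
    LipschitzWith 1 (fun x : EuclideanSpace ℝ (Fin n) => √(1 + ‖x‖ ^ 2)) := by
  apply LipschitzWith.of_le_add
  intro x y
  have h1 : ‖x‖ ≤ ‖y‖ + ‖x - y‖ := by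
    have := norm_add_le y (x - y)
    simpa using this
  rw [dist_eq_norm]
  have h2 : ‖y‖ ≤ √(1 + ‖y‖ ^ 2) := Real.le_sqrt_of_sq_le (by linarith)
  have h3 := Real.sq_sqrt (show 0 ≤ 1 + ‖y‖ ^ 2 by positivity)
  apply Real.sqrt_le_iff.2
  refine ⟨by positivity, ?_⟩
  nlinarith [norm_nonneg x, norm_nonneg y, norm_nonneg (x - y),
    mul_le_mul_of_nonneg_right h2 (norm_nonneg (x - y))]

theorem aux_cutoff (n : ℕ) : ∃ T : ℝ, 0 ≤ T ∧ ∀ R : ℝ,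
    ∃ ζ : EuclideanSpace ℝ (Fin n) → ℝ, ContDiff ℝ 1 ζ ∧ (∀ x, 0 ≤ ζ x) ∧ (∀ x, ζ x ≤ 1) ∧
      (∀ x, ‖fderiv ℝ ζ x‖ ≤ T) ∧ (∀ x, ‖x‖ < R → ζ x = 1 ∧ fderiv ℝ ζ x = 0) ∧
      tsupport ζ ⊆ closedBall 0 (R + 2) := by
  obtain ⟨T, hT⟩ := aux_step
  refine ⟨T, T.2, fun R => ⟨fun x => Real.smoothTransition (R + 2 - √(1 + ‖x‖ ^ 2)), ?_,
    fun x => Real.smoothTransition.nonneg _, fun x => Real.smoothTransition.le_one _, ?_, ?_, ?_⟩⟩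
  · apply Real.smoothTransition.contDiff.comp
    apply contDiff_const.sub
    apply ContDiff.sqrt
    · exact contDiff_const.add (contDiff_norm_sq ℝ)
    · intro x; positivity
  · intro x
    apply norm_fderiv_le_of_lipschitz
    have := hT.comp ((LipschitzWith.const (R + 2)).sub (aux_rho (n := n)))
    rw [zero_add, mul_one] at this
    exact this
  · intro x hx
    have h1 : Real.smoothTransition (R + 2 - √(1 + ‖x‖ ^ 2)) = 1 := by
      apply Real.smoothTransition.one_of_one_le
      have : √(1 + ‖x‖ ^ 2) ≤ 1 + ‖x‖ := by
        apply Real.sqrt_le_iff.2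
        constructor
        · positivity
        · nlinarith [norm_nonneg x]
      linarith
    refine ⟨h1, ?_⟩
    apply IsLocalMax.fderiv_eq_zero
    refine Eventually.of_forall fun v => ?_
    simp only [h1]
    exact Real.smoothTransition.le_one _
  · apply closure_minimal _ isClosed_closedBall
    intro x hx
    by_contra h
    apply hx
    apply Real.smoothTransition.zero_of_nonpos
    simp at h
    have h2 : ‖x‖ ≤ √(1 + ‖x‖ ^ 2) := Real.le_sqrt_of_sq_le (by linarith)
    linarith

theorem aux_gradSq_cont {n m : ℕ} (u : EuclideanSpace ℝ (Fin n) → EuclideanSpace ℝ (Fin m))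
    (hu : ContDiff ℝ 1 u) : Continuous (gradSq u) := by
  have := hu.continuous_fderiv (by norm_num)
  unfold gradSq
  fun_prop

theorem aux_gradSq_le {n m : ℕ} (u : EuclideanSpace ℝ (Fin n) → EuclideanSpace ℝ (Fin m))
    (hu : ContDiff ℝ 1 u) (a : EuclideanSpace ℝ (Fin m)) (ζ : EuclideanSpace ℝ (Fin n) → ℝ)
    (hζ : ContDiff ℝ 1 ζ) (h0 : ∀ x, 0 ≤ ζ x) (h1 : ∀ x, ζ x ≤ 1) (T : ℝ)
    (x : EuclideanSpace ℝ (Fin n)) (hT : ‖fderiv ℝ ζ x‖ ≤ T) :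
    gradSq (u + fun y => -(ζ y ^ 2 • (u y - a))) x ≤
      gradSq u x + n * (8 * T ^ 2 * ‖u x - a‖ ^ 2) := by
  have hs : (n : ℝ) * (8 * T ^ 2 * ‖u x - a‖ ^ 2) =
      ∑ i : Fin n, 8 * T ^ 2 * ‖u x - a‖ ^ 2 := by simp
  unfold gradSq
  rw [hs, ← Finset.sum_add_distrib]
  apply Finset.sum_le_sum
  intro i _
  have hux := (hu.differentiable (by norm_num) x).hasFDerivAt
  have hzx := (hζ.differentiable (by norm_num) x).hasFDerivAt
  have hd := hux.add ((hzx.pow 2).smul (hux.sub_const a)).neg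
  have hd' : fderiv ℝ (u + fun y => -(ζ y ^ 2 • (u y - a))) x = _ := hd.fderiv
  rw [hd']
  set e : EuclideanSpace ℝ (Fin n) := EuclideanSpace.single i 1 with he
  have hen : ‖e‖ = 1 := by simp [he]
  set p := fderiv ℝ u x e with hp
  set t := fderiv ℝ ζ x e with ht
  have htT : |t| ≤ T := by
    have := (fderiv ℝ ζ x).le_opNorm e
    rw [hen, mul_one, Real.norm_eq_abs] at this
    exact this.trans hT
  set z := ζ x with hz
  set q := u x - a with hq
  have heq : (fderiv ℝ u x + -(z ^ 2 • fderiv ℝ u x +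
      ((2 • z ^ (2 - 1)) • fderiv ℝ ζ x).smulRight q)) e
      = (1 - z ^ 2) • p - (2 * z * t) • q := by
    simp [← hp, ← ht]
    module
  have key : ‖(1 - z ^ 2) • p - (2 * z * t) • q‖ ^ 2 ≤ ‖p‖ ^ 2 + 8 * T ^ 2 * ‖q‖ ^ 2 := by
    have hz0 := h0 x
    have hz1 := h1 x
    rw [← hz] at hz0 hz1
    have hz2 : z ^ 2 ≤ 1 := by nlinarith
    have hT2 : |t| ^ 2 ≤ T ^ 2 := by gcongr
    have hn : ‖(1 - z ^ 2) • p - (2 * z * t) • q‖ ≤ (1 - z ^ 2) * ‖p‖ + 2 * z * |t| * ‖q‖ := by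
      refine (norm_sub_le _ _).trans (le_of_eq ?_)
      rw [norm_smul, norm_smul, Real.norm_of_nonneg (by linarith), norm_mul, norm_mul,
        Real.norm_of_nonneg hz0]
      simp
    have hP := norm_nonneg p
    have hQ := norm_nonneg q
    generalize ‖p‖ = P at *
    generalize ‖q‖ = Q at *
    generalize |t| = s at *
    calc _ ≤ ((1 - z ^ 2) * P + 2 * z * s * Q) ^ 2 := by gcongr
      _ ≤ P ^ 2 + 8 * s ^ 2 * Q ^ 2 := by
        have e1 : 0 ≤ z ^ 2 * (1 - z ^ 2) * P ^ 2 :=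
          mul_nonneg (mul_nonneg (sq_nonneg _) (by linarith)) (sq_nonneg _)
        have e2 : 0 ≤ (1 - z ^ 2) * (s ^ 2 * Q ^ 2) :=
          mul_nonneg (by linarith) (by positivity)
        have e3 : 0 ≤ (1 - z ^ 2) * (z * P - 2 * (s * Q)) ^ 2 :=
          mul_nonneg (by linarith) (by positivity)
        have e4 : 0 ≤ z ^ 2 * P ^ 2 := by positivity
        have e5 : 0 ≤ z ^ 2 * (s ^ 2 * Q ^ 2) := by positivity
        nlinarith
      _ ≤ _ := by gcongr
  rw [heq]
  exact key

theorem aux_decay (f : ℝ → ℝ) (hf0 : ∀ R, 0 ≤ f R) (n : ℕ) (A θ : ℝ) (hθ0 : 0 ≤ θ) (hθ : θ < 1)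
    (hstep : ∀ R, 0 ≤ R → f R ≤ θ * f (R + 3)) (hA : ∀ R, 0 ≤ R → f R ≤ A * R ^ n)
    (R : ℝ) (hR : 0 ≤ R) : f R = 0 := by
  have hit : ∀ k : ℕ, f R ≤ θ ^ k * f (R + 3 * k) := by
    intro k
    induction k with
    | zero => simp
    | succ k ih =>
      have := hstep (R + 3 * k) (by positivity)
      calc f R ≤ _ := ih
        _ ≤ θ ^ k * (θ * f (R + 3 * k + 3)) := by gcongr
        _ = _ := by push_cast; ring_nf
  have hA0 : 0 ≤ A := by
    have := (hf0 1).trans (hA 1 zero_le_one)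
    simpa using this
  have hb : ∀ᶠ k : ℕ in atTop, f R ≤ A * (R + 3) ^ n * ((k : ℝ) ^ n * θ ^ k) := by
    filter_upwards [eventually_ge_atTop 1] with k hk
    have hk' : (1 : ℝ) ≤ k := by exact_mod_cast hk
    calc f R ≤ _ := hit k
      _ ≤ θ ^ k * (A * (R + 3 * k) ^ n) := by
        gcongr
        exact hA _ (by positivity)
      _ ≤ θ ^ k * (A * ((R + 3) * k) ^ n) := by
        gcongr
        nlinarith
      _ = _ := by rw [mul_pow]; ring
  have hlim := (tendsto_pow_const_mul_const_pow_of_abs_lt_one n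
    (show |θ| < 1 by rwa [abs_of_nonneg hθ0])).const_mul (A * (R + 3) ^ n)
  rw [mul_zero] at hlim
  exact le_antisymm (ge_of_tendsto hlim hb) (hf0 R)

/-- Consequence of Theorem 1.1 and the nondegeneracy (1.8): for a bounded globally
minimizing solution, `R^{1-n} ∫_{B_R} |u - a|² dx → 0` as `R → ∞`. -/
theorem L2_closeness_of_nondegenerate
    (n m : ℕ) (hn : 2 ≤ n) (hm : 1 ≤ m)
    (W : EuclideanSpace ℝ (Fin m) → ℝ) (hW : ContDiff ℝ 2 W)
    (a : EuclideanSpace ℝ (Fin m))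
    (hWa : W a = 0) (hWpos : ∀ v, v ≠ a → 0 < W v)
    (hHess : ∀ ν : EuclideanSpace ℝ (Fin m), ‖ν‖ = 1 →
      0 < ⟪fderiv ℝ (fun v => gradient W v) a ν, ν⟫)
    (u : EuclideanSpace ℝ (Fin n) → EuclideanSpace ℝ (Fin m))
    (hu : ContDiff ℝ 2 u)
    (hbdd : ∃ C, ∀ x, ‖u x‖ ≤ C)
    (hsol : ∀ x, vlap u x = gradient W (u x))
    (hmin : GloballyMinimizing W u) :
    Tendsto
      (fun R : ℝ => (1 / R ^ (n - 1)) *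
        ∫ x in ball (0 : EuclideanSpace ℝ (Fin n)) R, ‖u x - a‖ ^ 2)
      atTop (nhds 0) := by
  obtain ⟨C, hC⟩ := hbdd
  have hu1 : ContDiff ℝ 1 u := hu.of_le (by norm_num)
  set M := C + ‖a‖ with hM
  have hq : ∀ x, ‖u x - a‖ ≤ M := fun x => (norm_sub_le _ _).trans (by linarith [hC x])
  have hM0 : 0 ≤ M := (norm_nonneg _).trans (hq 0)
  have hWnn : ∀ v, 0 ≤ W v := by
    intro v
    rcases eq_or_ne v a with h | h
    · rw [h, hWa]
    · exact (hWpos v h).le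
  obtain ⟨L, hL0, hL⟩ := aux_W_upper W hW a hWa hWpos M
  obtain ⟨c, hc0, hc⟩ := aux_W_lower W hW a hWa hWpos hHess M
  obtain ⟨T, hT0, hcut⟩ := aux_cutoff n
  set K : ℝ := L + n * (8 * T ^ 2) with hK
  have hK0 : 0 ≤ K := by positivity
  set f : ℝ → ℝ := fun R => ∫ x in ball (0 : EuclideanSpace ℝ (Fin n)) R, ‖u x - a‖ ^ 2 with hf
  have hqc : Continuous fun x => ‖u x - a‖ ^ 2 := by
    have := hu.continuous
    fun_prop
  have hint : ∀ (g : EuclideanSpace ℝ (Fin n) → ℝ), Continuous g → ∀ R : ℝ,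
      IntegrableOn g (ball 0 R) := fun g hg R =>
    (hg.continuousOn.integrableOn_compact (isCompact_closedBall 0 R)).mono_set
      ball_subset_closedBall
  have hf0 : ∀ R, 0 ≤ f R := fun R => integral_nonneg fun x => by positivity
  have hstep : ∀ R, 0 ≤ R → (K + c) * f R ≤ K * f (R + 3) := by
    intro R hR
    obtain ⟨ζ, hζ, hζ0, hζ1, hζT, hζR, hζs⟩ := hcut R
    set φ : EuclideanSpace ℝ (Fin n) → EuclideanSpace ℝ (Fin m) :=
      fun y => -(ζ y ^ 2 • (u y - a)) with hφ
    have hφc : ContDiff ℝ 1 φ := ((hζ.pow 2).smul (hu1.sub contDiff_const)).neg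
    have hts : tsupport φ ⊆ closedBall 0 (R + 2) := by
      refine (closure_mono ?_).trans hζs
      intro x hx h
      exact hx (by simp [hφ, h])
    have hcs : HasCompactSupport φ := (isCompact_closedBall _ _).of_isClosed_subset
      (isClosed_tsupport _) hts
    have hmn := hmin (ball 0 (R + 3)) isOpen_ball isBounded_ball φ
      (hφc.lipschitzWith_of_hasCompactSupport hcs (by norm_num))
      (hts.trans (closedBall_subset_ball (by linarith)))
    have hpt : ∀ x, (1 / 2) * gradSq (u + φ) x + W ((u + φ) x) ≤
        ((1 / 2) * gradSq u x + W (u x)) + (K * ‖u x - a‖ ^ 2 -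
          (ball (0 : EuclideanSpace ℝ (Fin n)) R).indicator
            (fun x => (K + c) * ‖u x - a‖ ^ 2) x) := by
      intro x
      have hw : (u + φ) x - a = (1 - ζ x ^ 2) • (u x - a) := by
        simp only [hφ, Pi.add_apply]
        module
      by_cases hx : x ∈ ball (0 : EuclideanSpace ℝ (Fin n)) R
      · rw [Set.indicator_of_mem hx]
        obtain ⟨e1, e2⟩ := hζR x (by simpa using hx)
        have hg := aux_gradSq_le u hu1 a ζ hζ hζ0 hζ1 0 x (by simp [e2])
        have hwa : (u + φ) x = a := by
          rw [e1] at hw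
          simpa [sub_eq_zero] using hw
        rw [hwa, hWa]
        have := hc (u x) (hq x)
        simp only [← hφ] at hg
        nlinarith
      · rw [Set.indicator_of_notMem hx]
        have hg := aux_gradSq_le u hu1 a ζ hζ hζ0 hζ1 T x (hζT x)
        simp only [← hφ] at hg
        have hle : ‖(u + φ) x - a‖ ≤ ‖u x - a‖ := by
          have hz2 : ζ x ^ 2 ≤ 1 := pow_le_one₀ (hζ0 x) (hζ1 x)
          rw [hw, norm_smul, Real.norm_of_nonneg (by linarith)]
          nlinarith [norm_nonneg (u x - a), sq_nonneg (ζ x)]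
        have h1 := hL _ (hle.trans (hq x))
        have h2 : L * ‖(u + φ) x - a‖ ^ 2 ≤ L * ‖u x - a‖ ^ 2 := by gcongr
        have h3 := hWnn (u x)
        have h4 : 0 ≤ (n : ℝ) * (8 * T ^ 2 * ‖u x - a‖ ^ 2) := by positivity
        have h5 : K * ‖u x - a‖ ^ 2 =
          L * ‖u x - a‖ ^ 2 + (n : ℝ) * (8 * T ^ 2 * ‖u x - a‖ ^ 2) := by rw [hK]; ring
        linarith
    have hcu : Continuous fun x => (1 / 2) * gradSq u x + W (u x) :=
      ((aux_gradSq_cont u hu1).const_mul _).add (hW.continuous.comp hu.continuous)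
    have hcw : Continuous fun x => (1 / 2) * gradSq (u + φ) x + W ((u + φ) x) :=
      ((aux_gradSq_cont _ (hu1.add hφc)).const_mul _).add
        (hW.continuous.comp (hu1.add hφc).continuous)
    have i1 := hint _ hcu (R + 3)
    have i2 := hint _ hcw (R + 3)
    have i3 := hint _ (hqc.const_mul K) (R + 3)
    have i4 : IntegrableOn ((ball (0 : EuclideanSpace ℝ (Fin n)) R).indicator
            (fun x => (K + c) * ‖u x - a‖ ^ 2)) (ball 0 (R + 3)) :=
      (hint _ (hqc.const_mul (K + c)) (R + 3)).indicator measurableSet_ball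
    have hI := integral_mono i2 (i1.add (i3.sub i4)) hpt
    unfold energy at hmn
    have e1 := integral_add i1 (i3.sub i4)
    have e2 := integral_sub i3 i4
    have e3 : ∫ x in ball (0 : EuclideanSpace ℝ (Fin n)) (R + 3),
        (ball (0 : EuclideanSpace ℝ (Fin n)) R).indicator
            (fun x => (K + c) * ‖u x - a‖ ^ 2) x = (K + c) * f R := by
      rw [setIntegral_indicator measurableSet_ball,
        Set.inter_eq_self_of_subset_right (ball_subset_ball (by linarith)), integral_const_mul]
    have e4 : ∫ x in ball (0 : EuclideanSpace ℝ (Fin n)) (R + 3), K * ‖u x - a‖ ^ 2 =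
      K * f (R + 3) := integral_const_mul _ _
    simp only [Pi.add_apply, Pi.sub_apply] at hI e1 e2 hmn
    rw [e1, e2, e3, e4] at hI
    linarith
  have hA : ∀ R, 0 ≤ R → f R ≤
      (M ^ 2 * volume.real (ball (0 : EuclideanSpace ℝ (Fin n)) 1)) * R ^ n := by
    intro R hR
    have h1 : f R ≤ ∫ x in ball (0 : EuclideanSpace ℝ (Fin n)) R, M ^ 2 := by
      apply integral_mono (hint _ hqc R) (hint _ continuous_const R)
      intro x
      have := hq x
      show ‖u x - a‖ ^ 2 ≤ M ^ 2
      gcongr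
    have : Nonempty (Fin n) := ⟨⟨0, by omega⟩⟩
    refine h1.trans (le_of_eq ?_)
    rw [setIntegral_const, smul_eq_mul, measureReal_def, measureReal_def,
      Measure.addHaar_ball _ _ hR, ENNReal.toReal_mul, ENNReal.toReal_ofReal (by positivity)]
    simp
    ring
  have hzero : ∀ R, 0 ≤ R → f R = 0 := by
    have hKc : 0 < K + c := by positivity
    refine aux_decay f hf0 n _ (K / (K + c)) (by positivity) ?_ ?_ hA
    · rw [div_lt_one hKc]; linarith
    · intro R hR
      rw [div_mul_eq_mul_div, le_div_iff₀ hKc]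
      linarith [hstep R hR]
  refine tendsto_const_nhds.congr' ?_
  filter_upwards [eventually_ge_atTop 0] with R hR
  have := hzero R hR
  simp only [hf] at this
  rw [this, mul_zero]
end
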